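/- Let G have a unique minimum-weight perfect matching M* with weight w* and 2w* < w_th. Working in R = 𝔽₂[X]/(X^{w_th}) with B_{i,j} = X^{w({i,j})} on edges, an edge {i,j} belongs to M* if and only if min-deg(det(B^{(i,j)}) · X^{w({i,j})}) = min-deg(det(B)), where min-deg of a nonzero element of R is the least exponent with nonzero coefficient in its canonical representative and the condition fails whenever the element is zero. -/

import Mathlib

open Polynomial Finset
open scoped Classical

noncomputable section

/-- The truncated polynomial ring `𝔽₂[X]/(X^{w_th})`. -/
abbrev Rq (n : ℕ) : Type :=
  Polynomial (ZMod 2) ⧸ Ideal.span {(X : Polynomial (ZMod 2)) ^ n}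

/-- The image of the indeterminate `X` in `𝔽₂[X]/(Xⁿ)`. -/
noncomputable def Xq (n : ℕ) : Rq n :=
  Ideal.Quotient.mk _ (X : Polynomial (ZMod 2))

/-- The canonical representative of degree `< n` of an element of `𝔽₂[X]/(Xⁿ)`. -/
noncomputable def rep (n : ℕ) (a : Rq n) : Polynomial (ZMod 2) :=
  (Ideal.Quotient.mk_surjective a).choose %ₘ ((X : Polynomial (ZMod 2)) ^ n)

/-- `M` is a perfect matching of `G` given as a set of edges. -/
def IsPM {m : ℕ} (G : SimpleGraph (Fin m)) (M : Finset (Sym2 (Fin m))) : Prop :=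
  (∀ e ∈ M, e ∈ G.edgeSet) ∧ ∀ v : Fin m, ∃! e, e ∈ M ∧ v ∈ e


section Alternating

variable {n K : Type*} [Fintype n]

theorem sum_sum_eq_zero_of_symm_of_charTwo {R : Type*} [CommRing R] [CharP R 2]
    (f : n → n → R) (hsymm : ∀ a b, f a b = f b a) (hdiag : ∀ a, f a a = 0) :
    ∑ a, ∑ b, f a b = 0 := by
  rw [← Finset.sum_product']
  refine Finset.sum_involution (fun p _ => p.swap) ?_ ?_ (by simp) (by simp)
  · rintro ⟨a, b⟩ -
    simp [hsymm b a, CharTwo.add_self_eq_zero]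
  · rintro ⟨a, b⟩ - h h'
    simp only [Prod.swap_prod_mk, Prod.mk.injEq] at h'
    exact h (by simpa [h'.1] using hdiag a)

variable [DecidableEq n]

theorem inv_apply_self_eq_zero_of_charTwo [Field K] [CharP K 2] (A : Matrix n n K)
    (hsymm : A.transpose = A) (hdiag : ∀ a, A a a = 0) (hA : IsUnit A.det) (i : n) :
    A⁻¹ i i = 0 := by
  have hC : (A⁻¹).transpose = A⁻¹ := by rw [Matrix.transpose_nonsing_inv, hsymm]
  have h : A⁻¹ = A⁻¹ * (A * (A⁻¹).transpose) := by
    rw [hC, Matrix.mul_nonsing_inv A hA, mul_one]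
  rw [h]
  simp only [Matrix.mul_apply, Matrix.transpose_apply, Finset.mul_sum]
  apply sum_sum_eq_zero_of_symm_of_charTwo
  · intro a b
    rw [← congr_fun₂ hsymm a b, Matrix.transpose_apply]
    ring
  · simp [hdiag]

theorem det_add_single_add_single_of_charTwo [Field K] [CharP K 2] (A : Matrix n n K)
    (hsymm : A.transpose = A) (hdiag : ∀ a, A a a = 0) (hA : A.det ≠ 0) (i j : n) (b : K) :
    (A + Matrix.single i j b + Matrix.single j i b).det * A.det =
      (A.det + b * A.adjugate i j) ^ 2 := by
  have hu : IsUnit A.det := hA.isUnit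
  let U : Matrix n (Fin 2) K := Matrix.of fun a k => if a = ![i, j] k then b else 0
  let V : Matrix (Fin 2) n K := Matrix.of fun k a => if a = ![j, i] k then 1 else 0
  have hUV : A + Matrix.single i j b + Matrix.single j i b = A + U * V := by
    ext a c
    simp only [Matrix.add_apply, Matrix.mul_apply, Fin.sum_univ_two, U, V, Matrix.single_apply,
      Matrix.of_apply, Matrix.cons_val_zero, Matrix.cons_val_one, add_assoc]
    congr 2 <;> grind
  have hC : A⁻¹ j i = A⁻¹ i j := by
    rw [← Matrix.transpose_apply A⁻¹, Matrix.transpose_nonsing_inv, hsymm]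
  have hent : ∀ k l, (V * A⁻¹ * U) k l = A⁻¹ (![j, i] k) (![i, j] l) * b := by
    intro k l
    simp [Matrix.mul_apply, U, V]
  have hadj : A.adjugate i j = A.det * A⁻¹ i j := by
    simp [Matrix.inv_def, hA]
  rw [hUV, Matrix.det_add_mul _ _ hu, Matrix.det_fin_two]
  simp only [Matrix.add_apply, hent]
  simp [hC, inv_apply_self_eq_zero_of_charTwo A hsymm hdiag hu, hadj]
  ring

theorem det_add_single_add_single_of_charTwo_of_isDomain {R : Type*} [CommRing R] [IsDomain R]
    [CharP R 2] (A : Matrix n n R)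
    (hsymm : A.transpose = A) (hdiag : ∀ a, A a a = 0) (hA : A.det ≠ 0) (i j : n) (b : R) :
    (A + Matrix.single i j b + Matrix.single j i b).det * A.det =
      (A.det + b * A.adjugate i j) ^ 2 := by
  let φ := algebraMap R (FractionRing R)
  have hφ : Function.Injective φ := IsFractionRing.injective R (FractionRing R)
  have : CharP (FractionRing R) 2 := charP_of_injective_algebraMap hφ 2
  have h := det_add_single_add_single_of_charTwo (φ.mapMatrix A)
    (by rw [RingHom.mapMatrix_apply, ← Matrix.transpose_map, hsymm]) (by simp [hdiag])
    (by rw [← RingHom.map_det]; exact (map_ne_zero_iff φ hφ).2 hA) i j (φ b)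
  apply hφ
  rw [← RingHom.map_adjugate] at h
  have e : φ.mapMatrix A + Matrix.single i j (φ b) + Matrix.single j i (φ b) =
      φ.mapMatrix (A + Matrix.single i j b + Matrix.single j i b) := by
    ext a c
    simp [Matrix.single_apply, apply_ite φ]
  rw [e, ← RingHom.map_det, ← RingHom.map_det] at h
  simpa using h

theorem det_eq_sum_involutive_of_charTwo {R : Type*} [CommRing R] [CharP R 2]
    (A : Matrix n n R) (hsymm : A.transpose = A) :
    A.det = ∑ σ : Equiv.Perm n with σ⁻¹ = σ, ∏ a, A a (σ a) := by
  have hdet : A.det = ∑ σ : Equiv.Perm n, ∏ a, A a (σ a) := by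
    rw [← Matrix.det_transpose, Matrix.det_apply']
    refine Finset.sum_congr rfl fun σ _ => ?_
    rcases Int.units_eq_one_or (Equiv.Perm.sign σ) with h | h <;>
      simp [h, CharTwo.neg_eq]
  rw [hdet, ← Finset.sum_filter_add_sum_filter_not _ (fun σ : Equiv.Perm n => σ⁻¹ = σ),
    add_eq_left]
  refine Finset.sum_involution (fun σ _ => σ⁻¹) ?_ ?_ ?_ (by simp)
  · intro σ _
    have : ∏ a, A a (σ⁻¹ a) = ∏ a, A a (σ a) := by
      rw [← Equiv.prod_comp σ]
      refine Finset.prod_congr rfl fun a _ => ?_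
      rw [Equiv.Perm.inv_def, σ.symm_apply_apply, ← congr_fun₂ hsymm, Matrix.transpose_apply]
    rw [this, CharTwo.add_self_eq_zero]
  · exact fun σ hσ _ => (Finset.mem_filter.1 hσ).2
  · intro σ hσ
    simpa [eq_comm] using hσ

end Alternating

section Matching

/-- The involutions of the vertex set that move every vertex to one of its neighbours. -/
def matchingPerms {m : ℕ} (G : SimpleGraph (Fin m)) : Finset (Equiv.Perm (Fin m)) :=
  {σ | σ⁻¹ = σ ∧ ∀ a, G.Adj a (σ a)}

/-- The edges joining each vertex to its image under a permutation. -/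
def permEdges {m : ℕ} (σ : Equiv.Perm (Fin m)) : Finset (Sym2 (Fin m)) :=
  Finset.univ.image fun a => s(a, σ a)

variable {m : ℕ} {G : SimpleGraph (Fin m)} {σ : Equiv.Perm (Fin m)}

theorem mem_matchingPerms : σ ∈ matchingPerms G ↔ σ⁻¹ = σ ∧ ∀ a, G.Adj a (σ a) := by
  simp [matchingPerms]

theorem apply_apply_of_inv_eq (h : σ⁻¹ = σ) (a : Fin m) : σ (σ a) = a := by
  nth_rw 1 [← h]
  simp

theorem mk_mem_permEdges (h : σ⁻¹ = σ) (a b : Fin m) : s(a, b) ∈ permEdges σ ↔ σ a = b := by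
  simp only [permEdges, Finset.mem_image, Finset.mem_univ, true_and]
  constructor
  · rintro ⟨c, hc⟩
    rcases Sym2.eq_iff.1 hc with ⟨rfl, hb⟩ | ⟨rfl, rfl⟩
    · exact hb
    · exact apply_apply_of_inv_eq h _
  · rintro rfl
    exact ⟨a, rfl⟩

theorem isPM_permEdges (hσ : σ ∈ matchingPerms G) : IsPM G (permEdges σ) := by
  obtain ⟨h, hG⟩ := mem_matchingPerms.1 hσ
  refine ⟨fun e he => ?_, fun v => ⟨s(v, σ v), ⟨(mk_mem_permEdges h _ _).2 rfl, by simp⟩, ?_⟩⟩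
  · obtain ⟨a, -, rfl⟩ := Finset.mem_image.1 he
    exact hG a
  · rintro e ⟨he, hv⟩
    obtain ⟨u, rfl⟩ := hv
    rw [(mk_mem_permEdges h _ _).1 he]

theorem exists_permEdges_eq {M : Finset (Sym2 (Fin m))} (hM : IsPM G M) :
    ∃ σ ∈ matchingPerms G, permEdges σ = M := by
  have hex : ∀ v, ∃ u, s(v, u) ∈ M := fun v => by
    obtain ⟨e, ⟨he, u, rfl⟩, -⟩ := hM.2 v
    exact ⟨u, he⟩
  choose f hf using hex
  have huniq : ∀ a b, s(a, b) ∈ M → f a = b := fun a b hab =>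
    Sym2.congr_right.1 ((hM.2 a).unique ⟨hf a, by simp⟩ ⟨hab, by simp⟩)
  have hinv : Function.Involutive f := fun a => huniq _ _ (Sym2.eq_swap ▸ hf a)
  have hself : (hinv.toPerm f)⁻¹ = hinv.toPerm f := rfl
  refine ⟨hinv.toPerm f, mem_matchingPerms.2 ⟨hself, fun a => hM.1 _ (hf a)⟩, ?_⟩
  ext ⟨a, b⟩
  rw [mk_mem_permEdges hself]
  exact ⟨fun h => h ▸ hf a, huniq a b⟩

theorem sum_apply_mk_eq_two_mul (hσ : σ ∈ matchingPerms G) (w : Sym2 (Fin m) → ℕ) :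
    ∑ a, w s(a, σ a) = 2 * ∑ e ∈ permEdges σ, w e := by
  obtain ⟨h, hG⟩ := mem_matchingPerms.1 hσ
  rw [Finset.sum_comp w (fun a => s(a, σ a)), Finset.mul_sum]
  refine Finset.sum_congr rfl fun e he => ?_
  obtain ⟨c, -, rfl⟩ := Finset.mem_image.1 he
  have : ({a | s(a, σ a) = s(c, σ c)} : Finset (Fin m)) = {c, σ c} := by
    ext a
    simp only [Finset.mem_filter, Finset.mem_univ, true_and, Finset.mem_insert,
      Finset.mem_singleton, Sym2.eq_iff]
    have := apply_apply_of_inv_eq h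
    grind
  rw [this, Finset.card_pair (hG c).ne, smul_eq_mul]

/-- The weighted adjacency matrix with entry `X ^ w e` at each edge `e`. -/
def edgeMatrix (G : SimpleGraph (Fin m)) (w : Sym2 (Fin m) → ℕ) :
    Matrix (Fin m) (Fin m) (ZMod 2)[X] :=
  Matrix.of fun a b => if G.Adj a b then X ^ w s(a, b) else 0

theorem transpose_edgeMatrix (G : SimpleGraph (Fin m)) (w : Sym2 (Fin m) → ℕ) :
    (edgeMatrix G w).transpose = edgeMatrix G w := by
  ext1 a b
  simp [edgeMatrix, G.adj_comm a b, Sym2.eq_swap (a := a)]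

theorem det_edgeMatrix (G : SimpleGraph (Fin m)) (w : Sym2 (Fin m) → ℕ) :
    (edgeMatrix G w).det =
      (∑ σ ∈ matchingPerms G, (X : (ZMod 2)[X]) ^ ∑ e ∈ permEdges σ, w e) ^ 2 := by
  rw [det_eq_sum_involutive_of_charTwo _ (transpose_edgeMatrix G w), CharTwo.sum_sq]
  symm
  refine Finset.sum_subset_zero_on_sdiff
    (fun σ hσ => by simpa using (mem_matchingPerms.1 hσ).1) (fun σ hσ => ?_) fun σ hσ => ?_
  · simp only [Finset.mem_sdiff, Finset.mem_filter, Finset.mem_univ, true_and,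
      mem_matchingPerms, not_and, not_forall] at hσ
    obtain ⟨a, ha⟩ := hσ.2 hσ.1
    exact Finset.prod_eq_zero (Finset.mem_univ a) (by simp [edgeMatrix, ha])
  · have hG := (mem_matchingPerms.1 hσ).2
    simp only [edgeMatrix, Matrix.of_apply, hG, if_true]
    rw [Finset.prod_pow_eq_pow_sum, sum_apply_mk_eq_two_mul hσ, ← pow_mul, mul_comm]

theorem matchingPerms_deleteEdges (G : SimpleGraph (Fin m)) (i j : Fin m) :
    matchingPerms (G.deleteEdges {s(i, j)}) = {σ ∈ matchingPerms G | σ i ≠ j} := by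
  ext σ
  simp only [mem_matchingPerms, Finset.mem_filter, SimpleGraph.deleteEdges_adj,
    Set.mem_singleton_iff, and_assoc]
  refine and_congr_right fun h => ⟨fun H => ⟨fun a => (H a).1, ?_⟩, fun H a => ⟨H.1 a, ?_⟩⟩
  · rintro rfl
    exact (H i).2 rfl
  · intro hs
    exact H.2 ((mk_mem_permEdges h i j).1 (hs ▸ (mk_mem_permEdges h _ _).2 rfl))

theorem edgeMatrix_deleteEdges {i j : Fin m} (hij : G.Adj i j) (w : Sym2 (Fin m) → ℕ) :
    edgeMatrix (G.deleteEdges {s(i, j)}) w =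
      edgeMatrix G w + Matrix.single i j (X ^ w s(i, j)) +
        Matrix.single j i (X ^ w s(i, j)) := by
  have hne := hij.ne
  have hji := hij.symm
  ext1 a b
  simp only [edgeMatrix, Matrix.add_apply, Matrix.of_apply, Matrix.single_apply,
    SimpleGraph.deleteEdges_adj, Set.mem_singleton_iff, Sym2.eq_iff]
  by_cases h1 : a = i ∧ b = j
  · obtain ⟨rfl, rfl⟩ := h1
    simp [hij, hne, CharTwo.add_self_eq_zero]
  by_cases h2 : a = j ∧ b = i
  · obtain ⟨rfl, rfl⟩ := h2
    simp [hji, hne, CharTwo.add_self_eq_zero, Sym2.eq_swap (a := a)]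
  · have h1' : ¬ (i = a ∧ j = b) := fun h => h1 ⟨h.1.symm, h.2.symm⟩
    have h2' : ¬ (j = a ∧ i = b) := fun h => h2 ⟨h.1.symm, h.2.symm⟩
    simp [h1, h2, h1', h2']

theorem mul_adjugate_edgeMatrix {i j : Fin m} (hij : G.Adj i j) (w : Sym2 (Fin m) → ℕ)
    (hdet : (edgeMatrix G w).det ≠ 0) :
    X ^ w s(i, j) * (edgeMatrix G w).adjugate i j =
      (∑ σ ∈ matchingPerms G, (X : (ZMod 2)[X]) ^ ∑ e ∈ permEdges σ, w e) *
        ∑ σ ∈ matchingPerms G with σ i = j, (X : (ZMod 2)[X]) ^ ∑ e ∈ permEdges σ, w e := by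
  have h := det_add_single_add_single_of_charTwo_of_isDomain (edgeMatrix G w)
    (transpose_edgeMatrix G w) (by simp [edgeMatrix]) hdet i j (X ^ w s(i, j))
  rw [← edgeMatrix_deleteEdges hij, det_edgeMatrix, det_edgeMatrix, matchingPerms_deleteEdges,
    ← mul_pow] at h
  have h' := CharTwo.sq_injective h
  rw [← Finset.sum_filter_add_sum_filter_not (matchingPerms G) (fun σ => σ i = j)] at h' ⊢
  set p := ∑ σ ∈ matchingPerms G with σ i = j, (X : (ZMod 2)[X]) ^ ∑ e ∈ permEdges σ, w e
  set q := ∑ σ ∈ matchingPerms G with ¬ σ i = j, (X : (ZMod 2)[X]) ^ ∑ e ∈ permEdges σ, w e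
  linear_combination -h' - (q * p + p ^ 2) * CharTwo.two_eq_zero (R := (ZMod 2)[X])

end Matching

section Truncation

theorem rep_mk (n : ℕ) (p : (ZMod 2)[X]) :
    rep n (Ideal.Quotient.mk _ p) = p %ₘ X ^ n := by
  have h := (Ideal.Quotient.mk_surjective
    (Ideal.Quotient.mk (Ideal.span {(X : (ZMod 2)[X]) ^ n}) p)).choose_spec
  rw [Ideal.Quotient.eq, Ideal.mem_span_singleton] at h
  exact Polynomial.modByMonic_eq_of_dvd_sub (monic_X_pow n) h

theorem coeff_rep_mk {n k : ℕ} (hk : k < n) (p : (ZMod 2)[X]) :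
    (rep n (Ideal.Quotient.mk _ p)).coeff k = p.coeff k := by
  rw [rep_mk, Polynomial.modByMonic_eq_sub_mul_div, Polynomial.coeff_sub,
    Polynomial.coeff_X_pow_mul', if_neg (by omega), sub_zero]

theorem natTrailingDegree_rep_mk {n k : ℕ} (hk : k < n) {p : (ZMod 2)[X]}
    (hlow : ∀ l < k, p.coeff l = 0) (hp : p.coeff k ≠ 0) :
    (rep n (Ideal.Quotient.mk _ p)).natTrailingDegree = k := by
  apply le_antisymm
  · exact natTrailingDegree_le_of_ne_zero (by rwa [coeff_rep_mk hk])
  · refine le_natTrailingDegree (fun h => hp ?_) fun l hl => ?_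
    · rw [← coeff_rep_mk hk, h, coeff_zero]
    · rw [coeff_rep_mk (hl.trans hk), hlow l hl]

theorem rep_ne_zero {n : ℕ} {a : Rq n} (ha : a ≠ 0) : rep n a ≠ 0 := by
  obtain ⟨p, rfl⟩ := Ideal.Quotient.mk_surjective a
  rw [rep_mk, Ne, Polynomial.modByMonic_eq_zero_iff_dvd (monic_X_pow n)]
  rwa [Ne, Ideal.Quotient.eq_zero_iff_mem, Ideal.mem_span_singleton] at ha

end Truncation

theorem exists_sum_X_pow_eq {α : Type*} [DecidableEq α] {T : Finset α} {f : α → ℕ} {a : α}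
    (hle : ∀ b ∈ T, f a ≤ f b) (huniq : ∀ b ∈ T, f b = f a → b = a) :
    ∃ u : (ZMod 2)[X], ∑ b ∈ T, X ^ f b = X ^ f a * u ∧
      u.coeff 0 = if a ∈ T then 1 else 0 := by
  refine ⟨∑ b ∈ T, X ^ (f b - f a), ?_, ?_⟩
  · rw [Finset.mul_sum]
    refine Finset.sum_congr rfl fun b hb => ?_
    rw [← pow_add, Nat.add_sub_cancel' (hle b hb)]
  · rw [finsetSum_coeff, ← Finset.sum_ite_eq' T a fun _ => (1 : ZMod 2)]
    refine Finset.sum_congr rfl fun b hb => ?_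
    rw [coeff_X_pow]
    refine if_congr ⟨fun h => huniq b hb ?_, ?_⟩ rfl rfl
    · have := hle b hb
      omega
    · rintro rfl
      simp

theorem det_submatrix_succAbove_eq_adjugate {R : Type*} [CommRing R] [CharP R 2] {m : ℕ}
    (A : Matrix (Fin (m + 1)) (Fin (m + 1)) R) (i j : Fin (m + 1)) :
    (A.submatrix i.succAbove j.succAbove).det = A.adjugate j i := by
  rw [Matrix.adjugate_fin_succ_eq_det_submatrix, CharTwo.neg_eq, one_pow, one_mul]

/-- Correctness of Step 4 of the overflow-safe decoder: with a unique MWPM `M*` of weight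
`w*` and `2w* < w_th`, working in `R = 𝔽₂[X]/(X^{w_th})`, an edge `{i,j}` belongs to `M*`
iff `det(B^{(i,j)})·X^{w({i,j})}` is nonzero and its minimal degree equals that of
`det B`. -/
theorem stmt18 (m : ℕ) (G : SimpleGraph (Fin (m + 1))) (w : Sym2 (Fin (m + 1)) → ℕ)
    (wth : ℕ) (Mstar : Finset (Sym2 (Fin (m + 1)))) (wstar : ℕ)
    (hMstar : IsPM G Mstar) (hwstar : wstar = ∑ e ∈ Mstar, w e)
    (hmin : ∀ M, IsPM G M → wstar ≤ ∑ e ∈ M, w e)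
    (huniq : ∀ M, IsPM G M → (∑ e ∈ M, w e) = wstar → M = Mstar)
    (hth : 2 * wstar < wth)
    (i j : Fin (m + 1)) (hadj : G.Adj i j) :
    s(i, j) ∈ Mstar ↔
      (((Matrix.of fun a b =>
            if G.Adj a b then (Xq wth) ^ (w s(a, b)) else 0).submatrix
              i.succAbove j.succAbove).det * (Xq wth) ^ (w s(i, j)) ≠ 0 ∧
        (rep wth (((Matrix.of fun a b =>
            if G.Adj a b then (Xq wth) ^ (w s(a, b)) else 0).submatrix
              i.succAbove j.succAbove).det * (Xq wth) ^ (w s(i, j)))).natTrailingDegree =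
          (rep wth ((Matrix.of fun a b =>
            if G.Adj a b then (Xq wth) ^ (w s(a, b)) else 0).det)).natTrailingDegree) := by
  obtain ⟨τ, hτ, rfl⟩ := exists_permEdges_eq hMstar
  have hτinv := (mem_matchingPerms.1 hτ).1
  set f : Equiv.Perm (Fin (m + 1)) → ℕ := fun σ => ∑ e ∈ permEdges σ, w e
  have hle : ∀ σ ∈ matchingPerms G, f τ ≤ f σ := fun σ hσ =>
    hwstar.symm.trans_le (hmin _ (isPM_permEdges hσ))
  have hun : ∀ σ ∈ matchingPerms G, f σ = f τ → σ = τ := fun σ hσ h => by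
    have hM := huniq _ (isPM_permEdges hσ) (h.trans hwstar.symm)
    ext1 a
    rw [← mk_mem_permEdges (mem_matchingPerms.1 hσ).1, hM, mk_mem_permEdges hτinv]
  obtain ⟨u, hu, hu0⟩ := exists_sum_X_pow_eq hle hun
  obtain ⟨v, hv, hv0⟩ := exists_sum_X_pow_eq (T := {σ ∈ matchingPerms G | σ j = i})
    (fun σ hσ => hle σ (Finset.mem_filter.1 hσ).1) (fun σ hσ => hun σ (Finset.mem_filter.1 hσ).1)
  have hD : (edgeMatrix G w).det = X ^ (2 * wstar) * u ^ 2 := by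
    rw [det_edgeMatrix, hu, hwstar]
    ring
  have hu0' : u.coeff 0 = 1 := by rw [hu0, if_pos hτ]
  have hD0 : (edgeMatrix G w).det.coeff (2 * wstar) ≠ 0 := by
    simp [hD, coeff_X_pow_mul', pow_two, mul_coeff_zero, hu0']
  have hP : (edgeMatrix G w).adjugate j i * X ^ w s(i, j) = X ^ (2 * wstar) * (u * v) := by
    have h := mul_adjugate_edgeMatrix hadj.symm w (fun h => hD0 (by rw [h, coeff_zero]))
    rw [hu, hv, Sym2.eq_swap] at h
    rw [mul_comm, h, hwstar]
    ring
  have hlow : ∀ q : (ZMod 2)[X], ∀ l < 2 * wstar, (X ^ (2 * wstar) * q).coeff l = 0 :=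
    fun q l hl => by rw [coeff_X_pow_mul', if_neg (by omega)]
  have hPcoeff : (X ^ (2 * wstar) * (u * v)).coeff (2 * wstar) =
      if s(i, j) ∈ permEdges τ then 1 else 0 := by
    rw [coeff_X_pow_mul', if_pos le_rfl, Nat.sub_self, mul_coeff_zero, hu0', one_mul, hv0,
      Sym2.eq_swap]
    simp [hτ, mk_mem_permEdges hτinv]
  have hmap : (Matrix.of fun a b => if G.Adj a b then (Xq wth) ^ (w s(a, b)) else 0) =
      (Ideal.Quotient.mk (Ideal.span {(X : (ZMod 2)[X]) ^ wth})).mapMatrix (edgeMatrix G w) := by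
    ext1 a b
    simp only [edgeMatrix, Matrix.of_apply, RingHom.mapMatrix_apply, Matrix.map_apply]
    split_ifs <;> simp [Xq]
  have hmapP : ((Matrix.of fun a b => if G.Adj a b then (Xq wth) ^ (w s(a, b)) else 0).submatrix
      i.succAbove j.succAbove).det * (Xq wth) ^ (w s(i, j)) =
      Ideal.Quotient.mk (Ideal.span {(X : (ZMod 2)[X]) ^ wth}) (X ^ (2 * wstar) * (u * v)) := by
    rw [← hP, ← det_submatrix_succAbove_eq_adjugate, map_mul, map_pow, RingHom.map_det, hmap]
    rfl
  rw [hmapP, hmap, ← RingHom.map_det,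
    natTrailingDegree_rep_mk hth (by rw [hD]; exact hlow _) hD0]
  constructor
  · intro hmem
    have hne : (X ^ (2 * wstar) * (u * v)).coeff (2 * wstar) ≠ 0 := by simp [hPcoeff, hmem]
    refine ⟨fun h => hne ?_, natTrailingDegree_rep_mk hth (hlow _) hne⟩
    rw [← coeff_rep_mk hth, h, ← map_zero (Ideal.Quotient.mk _), coeff_rep_mk hth, coeff_zero]
  · rintro ⟨hne, hdeg⟩
    by_contra hmem
    refine rep_ne_zero hne (trailingCoeff_eq_zero.1 ?_)
    rw [trailingCoeff, hdeg, coeff_rep_mk hth, hPcoeff, if_neg hmem]
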